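/- Let E be a vector lattice, F a K-space, and 𝒫 a generating set of band projections on L~(E,F). Let S, T ∈ L~(E,F) be positive and let T_S denote the band projection of T onto the band {S}^⊥⊥ in L~(E,F). Then for every e ∈ E₊ the following representations hold: (T − T_S)e = inf_{ε>0} sup{π((pT)e) : π a band projection of F, p ∈ 𝒫, π((pS)e) ≤ ε·Se}, and T_S e = sup_{ε>0} inf{((π̂∘p)^⊥ T)e : π a band projection of F, p ∈ 𝒫, π((pS)e) ≤ ε·Se}, where π̂ is the band projection T ↦ π∘T on L~(E,F) and (π̂∘p)^⊥ is the complement of the band projection π̂∘p. -/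

import Mathlib

/-! Statement 16: For a generating set `𝒫` of band projections on `L~(E,F)` and positive
operators `S, T`, the band projection `T_S` of `T` onto `{S}^⊥⊥` satisfies, for `e ∈ E₊`:
`(T − T_S)e = inf_{ε>0} sup{π((pT)e) : π ∈ 𝔓(F), p ∈ 𝒫, π((pS)e) ≤ ε·Se}` and
`T_S e = sup_{ε>0} inf{((π̂∘p)^⊥ T)e : π ∈ 𝔓(F), p ∈ 𝒫, π((pS)e) ≤ ε·Se}`,
where `((π̂∘p)^⊥ T)e = T e − π((pT)e)`.  Here `T_S` is characterized as the operator `h`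
with `0 ≤ h ≤ T`, `h ∈ {S}^⊥⊥`, and `T − h ⊥ S`. -/

universe u v

variable {E : Type u} {F : Type v}

/-- Order bounded: maps order intervals to order bounded sets. -/
def OrderBounded [Lattice E] [AddCommGroup E] [Module ℝ E]
    [Lattice F] [AddCommGroup F] [Module ℝ F] (T : E →ₗ[ℝ] F) : Prop :=
  ∀ a b : E, ∃ c d : F, ∀ x : E, a ≤ x → x ≤ b → c ≤ T x ∧ T x ≤ d

/-- The operator order: `S ≤ T` iff `S x ≤ T x` for all `x ≥ 0`. -/
def opLE [Lattice E] [AddCommGroup E] [Module ℝ E]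
    [Lattice F] [AddCommGroup F] [Module ℝ F] (S T : E →ₗ[ℝ] F) : Prop :=
  ∀ x : E, 0 ≤ x → S x ≤ T x

/-- `m = |T|` in `L~(E,F)`: the least order bounded upper bound of `{T, -T}`. -/
def IsModOp [Lattice E] [AddCommGroup E] [Module ℝ E]
    [Lattice F] [AddCommGroup F] [Module ℝ F] (T m : E →ₗ[ℝ] F) : Prop :=
  OrderBounded m ∧ opLE T m ∧ opLE (-T) m ∧
    ∀ R : E →ₗ[ℝ] F, OrderBounded R → opLE T R → opLE (-T) R → opLE m R

/-- The infimum in `L~(E,F)` of the two positive operators `u, v` is zero. -/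
def InfZeroOp [Lattice E] [AddCommGroup E] [Module ℝ E]
    [Lattice F] [AddCommGroup F] [Module ℝ F] (u v : E →ₗ[ℝ] F) : Prop :=
  opLE 0 u ∧ opLE 0 v ∧
    ∀ w : E →ₗ[ℝ] F, OrderBounded w → opLE w u → opLE w v → opLE w 0

/-- Disjointness in `L~(E,F)`: `|S| ∧ |T| = 0`. -/
def DisjOp [Lattice E] [AddCommGroup E] [Module ℝ E]
    [Lattice F] [AddCommGroup F] [Module ℝ F] (S T : E →ₗ[ℝ] F) : Prop :=
  ∃ mS mT : E →ₗ[ℝ] F, IsModOp S mS ∧ IsModOp T mT ∧ InfZeroOp mS mT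

/-- `T` belongs to the band `{S}^⊥⊥` generated by `S` in `L~(E,F)`. -/
def InBandOp [Lattice E] [AddCommGroup E] [Module ℝ E]
    [Lattice F] [AddCommGroup F] [Module ℝ F] (S T : E →ₗ[ℝ] F) : Prop :=
  ∀ R : E →ₗ[ℝ] F, OrderBounded R → DisjOp R S → DisjOp T R

/-- A band projection on the vector lattice `L~(E,F)` of order bounded operators. -/
def IsBandProjLb [Lattice E] [AddCommGroup E] [Module ℝ E]
    [Lattice F] [AddCommGroup F] [Module ℝ F]
    (P : (E →ₗ[ℝ] F) → (E →ₗ[ℝ] F)) : Prop :=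
  (∀ S T : E →ₗ[ℝ] F, P (S + T) = P S + P T) ∧
  (∀ (c : ℝ) (T : E →ₗ[ℝ] F), P (c • T) = c • P T) ∧
  (∀ T : E →ₗ[ℝ] F, P (P T) = P T) ∧
  (∀ T : E →ₗ[ℝ] F, OrderBounded T → OrderBounded (P T)) ∧
  (∀ T : E →ₗ[ℝ] F, OrderBounded T → opLE 0 T → opLE 0 (P T) ∧ opLE (P T) T)

/-- A band projection on `F`. -/
def IsBandProjection [Lattice F] [AddCommGroup F] [Module ℝ F] (π : F →ₗ[ℝ] F) : Prop :=
  π.comp π = π ∧ ∀ x : F, 0 ≤ x → 0 ≤ π x ∧ π x ≤ x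

section Helpers

set_option linter.unusedSectionVars false

variable [Lattice E] [AddCommGroup E] [Module ℝ E] [IsOrderedAddMonoid E] [PosSMulMono ℝ E]

/-- An additive, nonnegatively homogeneous map on the positive cone extends to a linear map. -/
theorem exists_linearMap_eq_on_cone [AddCommGroup F] [Module ℝ F] (f : E → F)
    (hadd : ∀ x y : E, 0 ≤ x → 0 ≤ y → f (x + y) = f x + f y)
    (hsmul : ∀ (c : ℝ) (x : E), 0 < c → 0 ≤ x → f (c • x) = c • f x) :
    ∃ L : E →ₗ[ℝ] F, ∀ x : E, 0 ≤ x → L x = f x := by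
  have hzero : f 0 = 0 := by simpa using hadd 0 0 le_rfl le_rfl
  have key : ∀ a b : E, 0 ≤ a → 0 ≤ b → f (a - b)⁺ - f (a - b)⁻ = f a - f b := by
    intro a b ha hb
    have h : a + (a - b)⁻ = b + (a - b)⁺ := by
      have := posPart_sub_negPart (a - b)
      rw [sub_eq_sub_iff_add_eq_add] at this
      rw [add_comm b, this]
    have h' := congrArg f h
    rw [hadd _ _ ha (negPart_nonneg _), hadd _ _ hb (posPart_nonneg _)] at h'
    rw [sub_eq_sub_iff_add_eq_add, add_comm, ← h', add_comm]
  have hneg : ∀ x : E, f (-x)⁺ - f (-x)⁻ = -(f x⁺ - f x⁻) := by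
    intro x
    rw [posPart_neg, negPart_neg]
    abel
  have hpos : ∀ (c : ℝ) (x : E), 0 < c →
      f (c • x)⁺ - f (c • x)⁻ = c • (f x⁺ - f x⁻) := by
    intro c x hc
    have := key (c • x⁺) (c • x⁻) (smul_nonneg hc.le (posPart_nonneg _))
      (smul_nonneg hc.le (negPart_nonneg _))
    rw [← smul_sub, posPart_sub_negPart, hsmul _ _ hc (posPart_nonneg _),
      hsmul _ _ hc (negPart_nonneg _)] at this
    rw [this, smul_sub]
  refine ⟨{ toFun := fun x => f x⁺ - f x⁻, map_add' := ?_, map_smul' := ?_ }, ?_⟩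
  · intro x y
    have := key (x⁺ + y⁺) (x⁻ + y⁻) (add_nonneg (posPart_nonneg _) (posPart_nonneg _))
      (add_nonneg (negPart_nonneg _) (negPart_nonneg _))
    rw [add_sub_add_comm, posPart_sub_negPart, posPart_sub_negPart,
      hadd _ _ (posPart_nonneg _) (posPart_nonneg _),
      hadd _ _ (negPart_nonneg _) (negPart_nonneg _)] at this
    rw [this]
    abel
  · intro c x
    simp only [RingHom.id_apply]
    rcases lt_trichotomy c 0 with hc | rfl | hc
    · have h := hpos (-c) (-x) (neg_pos.mpr hc)
      rw [smul_neg, neg_smul, neg_neg, hneg] at h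
      rw [h, smul_neg, neg_smul, neg_neg]
    · simp
    · exact hpos c x hc
  · intro x hx
    change f x⁺ - f x⁻ = f x
    rw [posPart_of_nonneg hx, negPart_of_nonneg hx, hzero, sub_zero]

variable [ConditionallyCompleteLattice F] [AddCommGroup F] [Module ℝ F]
  [IsOrderedAddMonoid F] [PosSMulMono ℝ F]

theorem isLUB_add_of_forall {A B C : Set F} {a b c : F} (hA : IsLUB A a) (hB : IsLUB B b)
    (hC : IsLUB C c) (hCle : ∀ z ∈ C, z ≤ a + b)
    (hle : ∀ x ∈ A, ∀ y ∈ B, x + y ≤ c) : c = a + b := by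
  refine le_antisymm (hC.2 hCle) ?_
  rw [← le_sub_iff_add_le]
  refine hA.2 fun x hx => ?_
  rw [le_sub_iff_add_le, add_comm, ← le_sub_iff_add_le]
  refine hB.2 fun y hy => ?_
  rw [le_sub_iff_add_le, add_comm]
  exact hle x hx y hy

theorem opLE.mono {T : E →ₗ[ℝ] F} (hT : opLE 0 T) {x y : E} (h : x ≤ y) : T x ≤ T y := by
  have := hT (y - x) (sub_nonneg.mpr h)
  rwa [LinearMap.zero_apply, map_sub, sub_nonneg] at this

theorem opLE.orderBounded {T : E →ₗ[ℝ] F} (hT : opLE 0 T) : OrderBounded T :=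
  fun a b => ⟨T a, T b, fun _ h₁ h₂ => ⟨hT.mono h₁, hT.mono h₂⟩⟩

theorem opLE.isModOp {T : E →ₗ[ℝ] F} (hT : opLE 0 T) : IsModOp T T := by
  refine ⟨hT.orderBounded, fun _ _ => le_rfl, fun x hx => ?_, fun _ _ h _ => h⟩
  exact (neg_nonpos.mpr (hT x hx)).trans (hT x hx)

theorem OrderBounded.sub {S T : E →ₗ[ℝ] F} (hS : OrderBounded S) (hT : OrderBounded T) :
    OrderBounded (S - T) := by
  intro a b
  obtain ⟨c, d, h⟩ := hS a b
  obtain ⟨c', d', h'⟩ := hT a b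
  exact ⟨c - d', d - c', fun x h₁ h₂ =>
    ⟨sub_le_sub (h x h₁ h₂).1 (h' x h₁ h₂).2, sub_le_sub (h x h₁ h₂).2 (h' x h₁ h₂).1⟩⟩

theorem opLE_zero_smul {S : E →ₗ[ℝ] F} (hS : opLE 0 S) {c : ℝ} (hc : 0 ≤ c) :
    opLE 0 (c • S) := fun x hx => smul_nonneg hc (hS x hx)

theorem smul_isLUB_eq {A B : Set F} {a b : F} {c : ℝ} (hc : 0 < c) (hA : IsLUB A a)
    (hB : IsLUB B b) (hAB : ∀ x ∈ A, c • x ≤ b) (hBA : ∀ y ∈ B, c⁻¹ • y ≤ a) :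
    b = c • a := by
  apply le_antisymm
  · refine hB.2 fun y hy => ?_
    have := smul_le_smul_of_nonneg_left (hBA y hy) hc.le
    rwa [smul_inv_smul₀ hc.ne'] at this
  · have : a ≤ c⁻¹ • b := hA.2 fun x hx => by
      have := smul_le_smul_of_nonneg_left (hAB x hx) (inv_nonneg.mpr hc.le)
      rwa [inv_smul_smul₀ hc.ne'] at this
    have := smul_le_smul_of_nonneg_left this hc.le
    rwa [smul_inv_smul₀ hc.ne'] at this

/-- The Riesz–Kantorovich formula for the positive part of an order bounded operator. -/
theorem OrderBounded.exists_posPart {T : E →ₗ[ℝ] F} (hT : OrderBounded T) :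
    ∃ P : E →ₗ[ℝ] F, ∀ x : E, 0 ≤ x → IsLUB (T '' Set.Icc 0 x) (P x) := by
  have hlub : ∀ x : E, 0 ≤ x → IsLUB (T '' Set.Icc 0 x) (sSup (T '' Set.Icc 0 x)) := by
    intro x hx
    refine isLUB_csSup ⟨_, Set.mem_image_of_mem T (Set.left_mem_Icc.mpr hx)⟩ ?_
    obtain ⟨c, d, h⟩ := hT 0 x
    exact ⟨d, by rintro _ ⟨y, hy, rfl⟩; exact (h y hy.1 hy.2).2⟩
  obtain ⟨P, hP⟩ : ∃ L : E →ₗ[ℝ] F, ∀ x : E, 0 ≤ x →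
      L x = sSup (T '' Set.Icc 0 x) := by
    refine exists_linearMap_eq_on_cone _ ?_ ?_
    · intro x y hx hy
      refine isLUB_add_of_forall (hlub x hx) (hlub y hy) (hlub _ (add_nonneg hx hy)) ?_ ?_
      · rintro _ ⟨z, hz, rfl⟩
        have hz' : T z = T (z ⊓ x) + T (z - z ⊓ x) := by rw [← map_add, add_sub_cancel]
        rw [hz']
        refine add_le_add ((hlub x hx).1 ⟨_, ⟨le_inf hz.1 hx, inf_le_right⟩, rfl⟩)
          ((hlub y hy).1 ⟨_, ⟨sub_nonneg.mpr inf_le_left, ?_⟩, rfl⟩)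
        rw [sub_le_comm]
        exact le_inf (sub_le_self _ hy) (sub_le_iff_le_add.mpr hz.2)
      · rintro _ ⟨u, hu, rfl⟩ _ ⟨v, hv, rfl⟩
        exact (hlub _ (add_nonneg hx hy)).1
          ⟨u + v, ⟨add_nonneg hu.1 hv.1, add_le_add hu.2 hv.2⟩, map_add _ _ _⟩
    · intro c x hc hx
      refine smul_isLUB_eq hc (hlub x hx) (hlub _ (smul_nonneg hc.le hx)) ?_ ?_
      · rintro _ ⟨y, hy, rfl⟩
        exact (hlub _ (smul_nonneg hc.le hx)).1 ⟨c • y, ⟨smul_nonneg hc.le hy.1,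
          smul_le_smul_of_nonneg_left hy.2 hc.le⟩, map_smul _ _ _⟩
      · rintro _ ⟨y, hy, rfl⟩
        refine (hlub _ hx).1 ⟨c⁻¹ • y, ⟨smul_nonneg (inv_nonneg.mpr hc.le) hy.1, ?_⟩,
          map_smul _ _ _⟩
        have := smul_le_smul_of_nonneg_left hy.2 (inv_nonneg.mpr hc.le)
        rwa [inv_smul_smul₀ hc.ne'] at this
  exact ⟨P, fun x hx => by rw [hP x hx]; exact hlub x hx⟩

section posPart

variable {T P : E →ₗ[ℝ] F}

theorem opLE_zero_of_isLUB (hP : ∀ x : E, 0 ≤ x → IsLUB (T '' Set.Icc 0 x) (P x)) :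
    opLE 0 P :=
  fun x hx => (hP x hx).1 ⟨0, Set.left_mem_Icc.mpr hx, map_zero T⟩

theorem opLE_of_isLUB (hP : ∀ x : E, 0 ≤ x → IsLUB (T '' Set.Icc 0 x) (P x)) :
    opLE T P :=
  fun x hx => (hP x hx).1 ⟨x, Set.right_mem_Icc.mpr hx, rfl⟩

theorem opLE_of_isLUB_of_opLE (hP : ∀ x : E, 0 ≤ x → IsLUB (T '' Set.Icc 0 x) (P x))
    {Q : E →ₗ[ℝ] F} (hQ : opLE 0 Q) (hTQ : opLE T Q) : opLE P Q := by
  refine fun x hx => (hP x hx).2 ?_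
  rintro _ ⟨y, hy, rfl⟩
  exact (hTQ y hy.1).trans (hQ.mono hy.2)

end posPart

/-- A decreasing sequence of positive operators has a pointwise infimum on the cone. -/
theorem exists_isGLB_of_antitone {V : ℕ → E →ₗ[ℝ] F} (hpos : ∀ n, opLE 0 (V n))
    (hanti : ∀ x : E, 0 ≤ x → Antitone fun n => V n x) :
    ∃ W : E →ₗ[ℝ] F, ∀ x : E, 0 ≤ x → IsGLB (Set.range fun n => V n x) (W x) := by
  have hlub : ∀ x : E, 0 ≤ x →
      IsLUB (Set.range fun n => -V n x) (sSup (Set.range fun n => -V n x)) := by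
    intro x hx
    refine isLUB_csSup ⟨_, 0, rfl⟩ ⟨0, ?_⟩
    rintro _ ⟨n, rfl⟩
    exact neg_nonpos.mpr (hpos n x hx)
  obtain ⟨W, hW⟩ : ∃ L : E →ₗ[ℝ] F, ∀ x : E, 0 ≤ x →
      L x = sSup (Set.range fun n => -V n x) := by
    refine exists_linearMap_eq_on_cone _ ?_ ?_
    · intro x y hx hy
      refine isLUB_add_of_forall (hlub x hx) (hlub y hy) (hlub _ (add_nonneg hx hy)) ?_ ?_
      · rintro _ ⟨n, rfl⟩
        simp only [map_add, neg_add]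
        exact add_le_add ((hlub x hx).1 ⟨n, rfl⟩) ((hlub y hy).1 ⟨n, rfl⟩)
      · rintro _ ⟨n, rfl⟩ _ ⟨m, rfl⟩
        refine le_trans ?_ ((hlub _ (add_nonneg hx hy)).1 ⟨max n m, rfl⟩)
        simp only [map_add, neg_add]
        exact add_le_add (neg_le_neg (hanti x hx (le_max_left _ _)))
          (neg_le_neg (hanti y hy (le_max_right _ _)))
    · intro c x hc hx
      refine smul_isLUB_eq hc (hlub x hx) (hlub _ (smul_nonneg hc.le hx)) ?_ ?_
      · rintro _ ⟨n, rfl⟩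
        exact (hlub _ (smul_nonneg hc.le hx)).1 ⟨n, by simp⟩
      · rintro _ ⟨n, rfl⟩
        exact (hlub _ hx).1 ⟨n, by simp [inv_smul_smul₀ hc.ne']⟩
  refine ⟨-W, fun x hx => ?_⟩
  have h := hlub x hx
  rw [← hW x hx] at h
  refine ⟨?_, fun b hb => ?_⟩
  · rintro _ ⟨n, rfl⟩
    exact neg_le.mp (h.1 ⟨n, rfl⟩)
  · refine le_neg.mpr (h.2 ?_)
    rintro _ ⟨n, rfl⟩
    exact neg_le_neg (hb ⟨n, rfl⟩)

theorem smul_le_smul_right_of_nonneg {a b : ℝ} {x : F} (h : a ≤ b) (hx : 0 ≤ x) :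
    a • x ≤ b • x := by
  have := smul_nonneg (sub_nonneg.mpr h) hx
  rwa [sub_smul, sub_nonneg] at this

theorem smul_inf_of_pos {c : ℝ} (hc : 0 < c) (x y : F) : c • (x ⊓ y) = c • x ⊓ c • y := by
  apply le_antisymm
  · exact le_inf (smul_le_smul_of_nonneg_left inf_le_left hc.le)
      (smul_le_smul_of_nonneg_left inf_le_right hc.le)
  · have : c⁻¹ • (c • x ⊓ c • y) ≤ x ⊓ y := by
      refine le_inf ?_ ?_
      · have := smul_le_smul_of_nonneg_left (inf_le_left (a := c • x) (b := c • y))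
          (inv_nonneg.mpr hc.le)
        rwa [inv_smul_smul₀ hc.ne'] at this
      · have := smul_le_smul_of_nonneg_left (inf_le_right (a := c • x) (b := c • y))
          (inv_nonneg.mpr hc.le)
        rwa [inv_smul_smul₀ hc.ne'] at this
    have := smul_le_smul_of_nonneg_left this hc.le
    rwa [smul_inv_smul₀ hc.ne'] at this

/-- For positive `x`, `u`, `v`: `(u + v) ⊓ x ≤ u ⊓ x + v ⊓ x`. -/
theorem add_inf_le_inf_add_inf {u v x : F} (hu : 0 ≤ u) (hv : 0 ≤ v) (hx : 0 ≤ x) :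
    (u + v) ⊓ x ≤ u ⊓ x + v ⊓ x := by
  rw [inf_add, add_inf, add_inf]
  refine le_inf (le_inf inf_le_left ?_) (le_inf ?_ ?_)
  · exact inf_le_right.trans (le_add_of_nonneg_left hu)
  · exact inf_le_right.trans (le_add_of_nonneg_right hv)
  · exact inf_le_right.trans (le_add_of_nonneg_right hx)

/-- The band projection of a Dedekind complete vector lattice onto the principal band
generated by `x ≥ 0`. -/
theorem exists_principal_bandProjection {x : F} (hx : 0 ≤ x) :
    ∃ π : F →ₗ[ℝ] F, IsBandProjection π ∧
      ∀ v : F, 0 ≤ v → IsLUB (Set.range fun n : ℕ => v ⊓ (n : ℝ) • x) (π v) := by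
  have hnx : ∀ n : ℕ, 0 ≤ (n : ℝ) • x := fun n => smul_nonneg n.cast_nonneg hx
  have hlub : ∀ v : F, 0 ≤ v → IsLUB (Set.range fun n : ℕ => v ⊓ (n : ℝ) • x)
      (sSup (Set.range fun n : ℕ => v ⊓ (n : ℝ) • x)) := by
    intro v hv
    refine isLUB_csSup ⟨_, 0, rfl⟩ ⟨v, ?_⟩
    rintro _ ⟨n, rfl⟩
    exact inf_le_left
  have hscale : ∀ (c : ℝ) (v : F), 0 < c → 0 ≤ v → ∀ n : ℕ,
      c • (v ⊓ (n : ℝ) • x) ≤ sSup (Set.range fun n : ℕ => (c • v) ⊓ (n : ℝ) • x) := by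
    intro c v hc hv n
    obtain ⟨k, hk⟩ := exists_nat_ge (c * n)
    rw [smul_inf_of_pos hc, smul_smul]
    exact (inf_le_inf_left _ (smul_le_smul_right_of_nonneg hk hx)).trans
      ((hlub _ (smul_nonneg hc.le hv)).1 ⟨k, rfl⟩)
  obtain ⟨π, hπ⟩ : ∃ L : F →ₗ[ℝ] F, ∀ v : F, 0 ≤ v →
      L v = sSup (Set.range fun n : ℕ => v ⊓ (n : ℝ) • x) := by
    refine exists_linearMap_eq_on_cone _ ?_ ?_
    · intro u v hu hv
      refine isLUB_add_of_forall (hlub u hu) (hlub v hv) (hlub _ (add_nonneg hu hv)) ?_ ?_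
      · rintro _ ⟨n, rfl⟩
        exact (add_inf_le_inf_add_inf hu hv (hnx n)).trans
          (add_le_add ((hlub u hu).1 ⟨n, rfl⟩) ((hlub v hv).1 ⟨n, rfl⟩))
      · rintro _ ⟨n, rfl⟩ _ ⟨m, rfl⟩
        refine le_trans (le_inf (add_le_add inf_le_left inf_le_left) ?_)
          ((hlub _ (add_nonneg hu hv)).1 ⟨n + m, rfl⟩)
        rw [Nat.cast_add, add_smul]
        exact add_le_add inf_le_right inf_le_right
    · intro c v hc hv
      refine smul_isLUB_eq hc (hlub v hv) (hlub _ (smul_nonneg hc.le hv)) ?_ ?_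
      · rintro _ ⟨n, rfl⟩
        exact hscale c v hc hv n
      · rintro _ ⟨n, rfl⟩
        have := hscale c⁻¹ (c • v) (inv_pos.mpr hc) (smul_nonneg hc.le hv) n
        rwa [inv_smul_smul₀ hc.ne'] at this
  have hlub' : ∀ v : F, 0 ≤ v →
      IsLUB (Set.range fun n : ℕ => v ⊓ (n : ℝ) • x) (π v) := fun v hv => by
    rw [hπ v hv]; exact hlub v hv
  have hbd : ∀ v : F, 0 ≤ v → 0 ≤ π v ∧ π v ≤ v := by
    intro v hv
    refine ⟨(le_inf hv (hnx 0)).trans ((hlub' v hv).1 ⟨0, rfl⟩), (hlub' v hv).2 ?_⟩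
    rintro _ ⟨n, rfl⟩
    exact inf_le_left
  have hidem : ∀ v : F, 0 ≤ v → π (π v) = π v := by
    intro v hv
    refine le_antisymm (hbd _ (hbd v hv).1).2 ((hlub' v hv).2 ?_)
    rintro _ ⟨n, rfl⟩
    exact (le_inf ((hlub' v hv).1 ⟨n, rfl⟩) inf_le_right).trans
      ((hlub' _ (hbd v hv).1).1 ⟨n, rfl⟩)
  refine ⟨π, ⟨?_, hbd⟩, hlub'⟩
  ext v
  rw [LinearMap.comp_apply, ← posPart_sub_negPart v, map_sub, map_sub,
    hidem _ (posPart_nonneg _), hidem _ (negPart_nonneg _)]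

theorem IsBandProjection.mono {π : F →ₗ[ℝ] F} (hπ : IsBandProjection π) {x y : F}
    (h : x ≤ y) : π x ≤ π y := by
  have := (hπ.2 (y - x) (sub_nonneg.mpr h)).1
  rwa [map_sub, sub_nonneg] at this

theorem IsBandProjection.compl {π : F →ₗ[ℝ] F} (hπ : IsBandProjection π) :
    IsBandProjection (LinearMap.id - π) := by
  refine ⟨?_, fun x hx => ?_⟩
  · ext x
    have : π (π x) = π x := LinearMap.congr_fun hπ.1 x
    simp [this]
  · simpa using ⟨(hπ.2 x hx).2, (hπ.2 x hx).1⟩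

/-- A principal band projection annihilates the elements disjoint from the generator. -/
theorem bandProjection_eq_zero_of_inf_eq_zero {π : F →ₗ[ℝ] F} {x v : F}
    (hπ : ∀ v : F, 0 ≤ v → IsLUB (Set.range fun n : ℕ => v ⊓ (n : ℝ) • x) (π v))
    (hx : 0 ≤ x) (hv : 0 ≤ v) (h : v ⊓ x = 0) : π v = 0 := by
  apply le_antisymm
  · refine (hπ v hv).2 ?_
    rintro _ ⟨n, rfl⟩
    have hn : (0 : ℝ) < n + 1 := by positivity
    have h1 : v ≤ ((n : ℝ) + 1) • v := by
      simpa using smul_le_smul_right_of_nonneg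
        (le_add_of_nonneg_left (n.cast_nonneg (α := ℝ)) : (1 : ℝ) ≤ n + 1) hv
    calc v ⊓ (n : ℝ) • x ≤ ((n : ℝ) + 1) • v ⊓ ((n : ℝ) + 1) • x :=
          inf_le_inf h1 (smul_le_smul_right_of_nonneg (by linarith) hx)
      _ = 0 := by rw [← smul_inf_of_pos hn, h, smul_zero]
  · exact (le_inf hv (by simp)).trans ((hπ v hv).1 ⟨0, rfl⟩)

theorem nonpos_of_forall_le_smul (hArch : ∀ x y : F, (∀ n : ℕ, n • x ≤ y) → x ≤ 0) {z y : F}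
    (hy : 0 ≤ y) (h : ∀ ε : ℝ, 0 < ε → z ≤ ε • y) : z ≤ 0 := by
  refine hArch z y fun n => ?_
  rcases Nat.eq_zero_or_pos n with rfl | hn
  · simpa using hy
  · have hn' : (0 : ℝ) < n := Nat.cast_pos.mpr hn
    have := smul_le_smul_of_nonneg_left (h (n : ℝ)⁻¹ (inv_pos.mpr hn')) hn'.le
    rwa [smul_inv_smul₀ hn'.ne', Nat.cast_smul_eq_nsmul] at this

/-- A positive element of the principal band of `s` that lies below all `(r - n s)⁺` vanishes. -/
theorem nonpos_of_forall_le_bandProjection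
    (hArch : ∀ x y : F, (∀ n : ℕ, n • x ≤ y) → x ≤ 0) {σ : F →ₗ[ℝ] F} {r s d : F}
    (hs : 0 ≤ s) (hr : 0 ≤ r) (hσ : IsBandProjection σ)
    (hσs : ∀ v : F, 0 ≤ v → IsLUB (Set.range fun n : ℕ => v ⊓ (n : ℝ) • s) (σ v))
    (h : ∀ n : ℕ, d ≤ σ (r - (n : ℝ) • s)⁺) : d ≤ 0 := by
  have hd : ∀ n : ℕ, d⁺ ≤ σ (r - (n : ℝ) • s)⁺ := fun n =>
    sup_le (h n) (hσ.2 _ (posPart_nonneg _)).1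
  have hd' : ∀ n : ℕ, d⁺ ≤ (r - (n : ℝ) • s)⁺ := fun n =>
    (hd n).trans (hσ.2 _ (posPart_nonneg _)).2
  have hu : d⁺ ⊓ s = 0 := by
    refine le_antisymm (hArch _ r fun n => ?_) (le_inf (posPart_nonneg _) hs)
    have key : ∀ n : ℕ, (r - (n : ℝ) • s)⁺ + n • (d⁺ ⊓ s) ≤ r := by
      intro n
      induction n with
      | zero => simp [posPart_of_nonneg hr]
      | succ n ih =>
        refine le_trans ?_ ih
        rw [succ_nsmul', ← add_assoc]
        refine add_le_add_left ?_ _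
        rw [← le_sub_iff_add_le]
        refine sup_le ?_ (sub_nonneg.mpr (inf_le_left.trans (hd' n)))
        push_cast
        rw [add_smul, one_smul, ← sub_sub]
        exact sub_le_sub (le_posPart _) inf_le_right
    exact (le_add_of_nonneg_left (posPart_nonneg _)).trans (key n)
  have hσd : σ d⁺ = 0 := bandProjection_eq_zero_of_inf_eq_zero hσs hs (posPart_nonneg _) hu
  have h1 := hσ.compl.mono (hd 0)
  have h2 : σ (σ (r - ((0 : ℕ) : ℝ) • s)⁺) = σ (r - ((0 : ℕ) : ℝ) • s)⁺ :=
    LinearMap.congr_fun hσ.1 _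
  simp only [LinearMap.sub_apply, LinearMap.id_apply, h2, sub_self, hσd, sub_zero] at h1
  exact (le_posPart d).trans h1

theorem IsBandProjLb.mono {p : (E →ₗ[ℝ] F) → (E →ₗ[ℝ] F)} (hp : IsBandProjLb p)
    {A B : E →ₗ[ℝ] F} (hA : OrderBounded A) (hB : OrderBounded B) (h : opLE A B) :
    opLE (p A) (p B) := by
  intro x hx
  have hBA : opLE 0 (B - A) := fun y hy => sub_nonneg.mpr (h y hy)
  have h0 := (hp.2.2.2.2 (B - A) (hB.sub hA) hBA).1 x hx
  have h1 : p B = p (B - A) + p A := by rw [← hp.1, sub_add_cancel]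
  rw [h1]
  exact le_add_of_nonneg_left h0

theorem DisjOp.opLE_zero {A B W : E →ₗ[ℝ] F} (h : DisjOp A B) (hW : OrderBounded W)
    (hA : opLE W A) (hB : opLE W B) : opLE W 0 := by
  obtain ⟨m, m', hm, hm', h0⟩ := h
  exact h0.2.2 W hW (fun x hx => (hA x hx).trans (hm.2.1 x hx))
    (fun x hx => (hB x hx).trans (hm'.2.1 x hx))

/-- Disjoint positive operators satisfy `R e = sup {R y - S y : 0 ≤ y ≤ e}`. -/
theorem DisjOp.le_of_forall_sub_le {R S : E →ₗ[ℝ] F} (hR : opLE 0 R) (hS : opLE 0 S)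
    (h : DisjOp R S) {e : E} (he : 0 ≤ e) {b : F}
    (hb : ∀ y : E, 0 ≤ y → y ≤ e → R y - S y ≤ b) : R e ≤ b := by
  have hRS := hR.orderBounded.sub hS.orderBounded
  obtain ⟨P, hP⟩ := hRS.exists_posPart
  have hP0 := opLE_zero_of_isLUB hP
  have hW := h.opLE_zero (W := R - P) (hR.orderBounded.sub hP0.orderBounded)
    (fun x hx => sub_le_self _ (hP0 x hx))
    (fun x hx => by
      have : R x - S x ≤ P x := opLE_of_isLUB hP x hx
      exact sub_le_comm.mp this)
  refine (sub_nonpos.mp (hW e he)).trans ((hP e he).2 ?_)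
  rintro _ ⟨y, hy, rfl⟩
  exact hb y hy.1 hy.2

/-- If `Ps` is generating and `R ⊥ S`, then `R e ≤ sup {p R e - c p S e : p ∈ Ps}`. -/
theorem DisjOp.le_of_forall_generating {R S : E →ₗ[ℝ] F} (hR : opLE 0 R) (hS : opLE 0 S)
    (h : DisjOp R S) {Ps : Set ((E →ₗ[ℝ] F) → (E →ₗ[ℝ] F))}
    (hPs : ∀ p ∈ Ps, IsBandProjLb p)
    (hgen : ∀ T : E →ₗ[ℝ] F, OrderBounded T → opLE 0 T →
      ∀ x : E, IsLUB ((fun p => p T x) '' Ps) (T (x ⊔ 0)))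
    {e : E} (he : 0 ≤ e) {c : ℝ} (hc : 0 ≤ c) {b : F}
    (hb : ∀ p ∈ Ps, p R e - c • p S e ≤ b) : R e ≤ b := by
  have hU : opLE 0 (R + S) := fun x hx => add_nonneg (hR x hx) (hS x hx)
  have hc1 : 0 < 1 + c := by linarith
  suffices hsuff : R e ≤ (1 + c)⁻¹ • (b + c • R e) by
    have := smul_le_smul_of_nonneg_left hsuff hc1.le
    rw [smul_inv_smul₀ hc1.ne', add_smul, one_smul] at this
    exact le_of_add_le_add_right this
  refine h.le_of_forall_sub_le hR hS he fun y hy hye => ?_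
  suffices hsuff : (1 + c) • (R y - S y) ≤ b + c • R e by
    have := smul_le_smul_of_nonneg_left hsuff (inv_nonneg.mpr hc1.le)
    rwa [inv_smul_smul₀ hc1.ne'] at this
  set x := y - c • (e - y) with hx
  have hup : (R + S) (x ⊔ 0) ≤ b + (1 + c) • S y := by
    refine (hgen _ hU.orderBounded hU x).2 ?_
    rintro _ ⟨p, hp, rfl⟩
    have hpR := (hPs p hp).2.2.2.2 R hR.orderBounded hR
    have hpS := (hPs p hp).2.2.2.2 S hS.orderBounded hS
    have h1 : p R y ≤ p R e := hpR.1.mono hye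
    have h2 : 0 ≤ c • p R (e - y) := smul_nonneg hc (hpR.1 _ (sub_nonneg.mpr hye))
    have h3 : (1 + c) • p S y ≤ (1 + c) • S y :=
      smul_le_smul_of_nonneg_left (hpS.2 y hy) hc1.le
    have h4 := hb p hp
    calc p (R + S) x = (p R e - c • p S e) + (1 + c) • p S y
          - (p R e - p R y) - c • p R (e - y) := by
          rw [(hPs p hp).1, hx]
          simp only [LinearMap.add_apply, map_sub, map_smul]
          module
      _ ≤ (p R e - c • p S e) + (1 + c) • p S y :=
          (sub_le_self _ h2).trans (sub_le_self _ (sub_nonneg.mpr h1))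
      _ ≤ b + (1 + c) • S y := add_le_add h4 h3
  have hlow : (1 + c) • R y - c • R e ≤ (R + S) (x ⊔ 0) := by
    calc (1 + c) • R y - c • R e = R x := by
          rw [hx]
          simp only [map_sub, map_smul]
          module
      _ ≤ R (x ⊔ 0) := hR.mono le_sup_left
      _ ≤ (R + S) (x ⊔ 0) := le_add_of_nonneg_right (hS _ le_sup_right)
  rw [smul_sub, sub_le_iff_le_add]
  rw [sub_le_iff_le_add] at hlow
  calc (1 + c) • R y ≤ _ := hlow
    _ ≤ b + (1 + c) • S y + c • R e := add_le_add_left hup _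
    _ = _ := by abel

/-- If `H ∈ {S}^⊥⊥` is positive then the operators `(H - n S)⁺` decrease to zero. -/
theorem InBandOp.nonpos_of_forall_le (hArch : ∀ x y : F, (∀ n : ℕ, n • x ≤ y) → x ≤ 0)
    {S H : E →ₗ[ℝ] F} (hS : opLE 0 S) (hH : opLE 0 H) (hband : InBandOp S H)
    {e : E} (he : 0 ≤ e) {b : F}
    (hb : ∀ (n : ℕ) (V : E →ₗ[ℝ] F), opLE 0 V → opLE (H - (n : ℝ) • S) V →
      opLE V H → b ≤ V e) : b ≤ 0 := by
  have hex : ∀ n : ℕ, ∃ P : E →ₗ[ℝ] F,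
      ∀ x : E, 0 ≤ x →
        IsLUB ((H - (n : ℝ) • S : E →ₗ[ℝ] F) '' Set.Icc 0 x) (P x) := fun n =>
    (hH.orderBounded.sub (opLE_zero_smul hS n.cast_nonneg).orderBounded).exists_posPart
  choose V hV using hex
  have hV0 : ∀ n, opLE 0 (V n) := fun n => opLE_zero_of_isLUB (hV n)
  have hVle : ∀ n : ℕ, opLE (H - (n : ℝ) • S) (V n) := fun n => opLE_of_isLUB (hV n)
  have hanti : ∀ x : E, 0 ≤ x → Antitone fun n => V n x := by
    intro x hx n m hnm
    refine opLE_of_isLUB_of_opLE (hV m) (hV0 n) (fun y hy => le_trans ?_ (hVle n y hy)) x hx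
    exact sub_le_sub_left
      (smul_le_smul_right_of_nonneg (Nat.cast_le.mpr hnm) (hS y hy)) (H y)
  have hVH : ∀ n, opLE (V n) H := fun n =>
    opLE_of_isLUB_of_opLE (hV n) hH fun x hx =>
      sub_le_self _ (smul_nonneg n.cast_nonneg (hS x hx))
  obtain ⟨W, hW⟩ := exists_isGLB_of_antitone hV0 hanti
  have hW0 : opLE 0 W := fun x hx => (hW x hx).2 (by rintro _ ⟨n, rfl⟩; exact hV0 n x hx)
  have hWV : ∀ n, opLE W (V n) := fun n x hx => (hW x hx).1 ⟨n, rfl⟩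
  have hdisj : DisjOp W S := by
    refine ⟨W, S, hW0.isModOp, hS.isModOp, hW0, hS, fun w hw hwW hwS => ?_⟩
    obtain ⟨Q, hQ⟩ := hw.exists_posPart
    have hQ0 := opLE_zero_of_isLUB hQ
    have hQW := opLE_of_isLUB_of_opLE hQ hW0 hwW
    have hQS := opLE_of_isLUB_of_opLE hQ hS hwS
    have key : ∀ n : ℕ, opLE (V n + n • Q) H := by
      intro n
      induction n with
      | zero => simpa using hVH 0
      | succ n ih =>
        have hstep : opLE (V (n + 1)) (V n - Q) := by
          refine opLE_of_isLUB_of_opLE (hV (n + 1))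
            (fun x hx => sub_nonneg.mpr ((hQW x hx).trans (hWV n x hx))) fun x hx => ?_
          have h1 := sub_le_sub (hVle n x hx) (hQS x hx)
          refine le_trans (le_of_eq ?_) h1
          simp only [LinearMap.sub_apply, LinearMap.smul_apply]
          push_cast
          module
        intro x hx
        refine le_trans ?_ (ih x hx)
        have h1 := add_le_add_left (hstep x hx) ((n + 1) • Q x)
        refine h1.trans (le_of_eq ?_)
        simp only [LinearMap.sub_apply, LinearMap.add_apply, LinearMap.smul_apply]
        module
    intro x hx
    refine (opLE_of_isLUB hQ x hx).trans (hArch _ (H x) fun n => ?_)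
    exact (le_add_of_nonneg_left (hV0 n x hx)).trans (key n x hx)
  have hzero := (hband W hW0.orderBounded hdisj).opLE_zero hW0.orderBounded
    (fun x hx => (hWV 0 x hx).trans (hVH 0 x hx)) (fun _ _ => le_rfl)
  refine le_trans ((hW e he).2 ?_) (hzero e he)
  rintro _ ⟨n, rfl⟩
  exact hb n (V n) (hV0 n) (hVle n) (hVH n)

/-- Localization: any upper bound of the elements `π (p T e)` with `π (p S e) ≤ ε S e`
dominates `R e` whenever `R ≤ T` is disjoint from `S`. -/
theorem DisjOp.le_of_forall_localized (hArch : ∀ x y : F, (∀ n : ℕ, n • x ≤ y) → x ≤ 0)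
    {R S T : E →ₗ[ℝ] F} (hR : opLE 0 R) (hS : opLE 0 S) (hT : OrderBounded T)
    (hRT : opLE R T) (h : DisjOp R S) {Ps : Set ((E →ₗ[ℝ] F) → (E →ₗ[ℝ] F))}
    (hPs : ∀ p ∈ Ps, IsBandProjLb p)
    (hgen : ∀ T : E →ₗ[ℝ] F, OrderBounded T → opLE 0 T →
      ∀ x : E, IsLUB ((fun p => p T x) '' Ps) (T (x ⊔ 0)))
    {e : E} (he : 0 ≤ e) {ε : ℝ} (hε : 0 < ε) {a : F}
    (ha : ∀ π : F →ₗ[ℝ] F, ∀ p ∈ Ps, IsBandProjection π → π (p S e) ≤ ε • S e →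
      π (p T e) ≤ a) : R e ≤ a := by
  have hs : 0 ≤ S e := hS e he
  obtain ⟨σ, hσ, hσs⟩ := exists_principal_bandProjection hs
  rw [← sub_nonpos]
  refine nonpos_of_forall_le_bandProjection hArch hs (hR e he) hσ hσs fun n => ?_
  rw [sub_le_iff_le_add]
  refine h.le_of_forall_generating hR hS hPs hgen he
    (c := n / ε) (by positivity) fun p hp => ?_
  have hpR := (hPs p hp).2.2.2.2 R hR.orderBounded hR
  have hpS := (hPs p hp).2.2.2.2 S hS.orderBounded hS
  set x := p S e - ε • S e with hx
  obtain ⟨ρ, hρ, hρx⟩ := exists_principal_bandProjection (posPart_nonneg x)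
  have hneg : ρ x⁻ = 0 := bandProjection_eq_zero_of_inf_eq_zero hρx (posPart_nonneg x)
    (negPart_nonneg x) (by rw [inf_comm]; exact posPart_inf_negPart_eq_zero x)
  have hposx : ρ x⁺ = x⁺ := by
    refine le_antisymm (hρ.2 _ (posPart_nonneg x)).2 ?_
    have := (hρx _ (posPart_nonneg x)).1 ⟨1, rfl⟩
    simpa using this
  have hρx0 : ρ x = x⁺ := by
    conv_lhs => rw [← posPart_sub_negPart x]
    rw [map_sub, hneg, hposx, sub_zero]
  have hmem : (LinearMap.id - ρ : F →ₗ[ℝ] F) (p S e) ≤ ε • S e := by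
    have h1 : (LinearMap.id - ρ : F →ₗ[ℝ] F) (p S e) = (LinearMap.id - ρ : F →ₗ[ℝ] F) (ε • S e) + (x - ρ x) := by
      rw [hx]
      simp only [LinearMap.sub_apply, LinearMap.id_apply, map_sub]
      abel
    have h2 : x - ρ x ≤ 0 := by rw [hρx0]; exact sub_nonpos.mpr (le_posPart x)
    rw [h1]
    exact (add_le_of_nonpos_right h2).trans
      (hρ.compl.2 _ (smul_nonneg hε.le hs)).2
  have hA : (LinearMap.id - ρ : F →ₗ[ℝ] F) (p R e) ≤ a :=
    (hρ.compl.mono ((hPs p hp).mono hR.orderBounded hT hRT e he)).trans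
      (ha _ p hp hρ.compl hmem)
  have hB : ρ (p R e) ≤ ρ (R e) := hρ.mono (hpR.2 e he)
  have hnε : (0 : ℝ) ≤ n / ε := by positivity
  have hC : (n : ℝ) • ρ (S e) ≤ (n / ε) • p S e := by
    have h1 : ε • ρ (S e) ≤ ρ (p S e) := by
      have : 0 ≤ ρ x := by rw [hρx0]; exact posPart_nonneg x
      rwa [hx, map_sub, map_smul, sub_nonneg] at this
    have h2 := smul_le_smul_of_nonneg_left
      (h1.trans (hρ.2 _ (hpS.1 e he)).2) hnε
    rwa [smul_smul, div_mul_cancel₀ _ hε.ne'] at h2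
  have hxS : x⁺ ≤ S e :=
    sup_le ((sub_le_self _ (smul_nonneg hε.le hs)).trans (hpS.2 e he)) hs
  have hD : ρ (R e - (n : ℝ) • S e)⁺ ≤ σ (R e - (n : ℝ) • S e)⁺ := by
    refine (hρx _ (posPart_nonneg _)).2 ?_
    rintro _ ⟨k, rfl⟩
    exact (inf_le_inf_left _ (smul_le_smul_of_nonneg_left hxS k.cast_nonneg)).trans
      ((hσs _ (posPart_nonneg _)).1 ⟨k, rfl⟩)
  calc p R e - ((n : ℝ) / ε) • p S e
      = ρ (p R e) + (LinearMap.id - ρ : F →ₗ[ℝ] F) (p R e) - ((n : ℝ) / ε) • p S e := by simp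
    _ ≤ ρ (R e) + a - (n : ℝ) • ρ (S e) := sub_le_sub (add_le_add hB hA) hC
    _ = ρ (R e - (n : ℝ) • S e) + a := by
        rw [map_sub, map_smul]
        abel
    _ ≤ σ (R e - (n : ℝ) • S e)⁺ + a :=
        add_le_add_left ((hρ.mono (le_posPart _)).trans hD) _

/-- For `H ∈ {S}^⊥⊥`, a lower bound of the suprema of `π (p (R + H) e)` over
`π (p S e) ≤ ε S e`, `ε > 0`, lies below `R e`. -/
theorem InBandOp.le_of_forall_localized (hArch : ∀ x y : F, (∀ n : ℕ, n • x ≤ y) → x ≤ 0)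
    {R S H : E →ₗ[ℝ] F} (hR : opLE 0 R) (hS : opLE 0 S) (hH : opLE 0 H)
    (hband : InBandOp S H) {Ps : Set ((E →ₗ[ℝ] F) → (E →ₗ[ℝ] F))}
    (hPs : ∀ p ∈ Ps, IsBandProjLb p) {e : E} (he : 0 ≤ e) {b : F}
    (hb : ∀ (ε : ℝ) (a : F), 0 < ε →
      (∀ π : F →ₗ[ℝ] F, ∀ p ∈ Ps, IsBandProjection π → π (p S e) ≤ ε • S e →
        π (p (R + H) e) ≤ a) → b ≤ a) : b ≤ R e := by
  rw [← sub_nonpos]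
  refine hband.nonpos_of_forall_le hArch hS hH he fun n V hV0 hVle hVH => ?_
  rw [← sub_nonpos]
  refine nonpos_of_forall_le_smul hArch (hS e he) fun ε hε => ?_
  have hn : (0 : ℝ) < n + 1 := by positivity
  rw [sub_le_iff_le_add, sub_le_iff_le_add]
  refine hb (ε / (n + 1)) _ (by positivity) fun π p hp hπ hpe => ?_
  have hHV : opLE (H - V) ((n : ℝ) • S) := fun x hx => sub_le_comm.mp (hVle x hx)
  have h1 : π (p R e) ≤ R e := by
    have h := (hPs p hp).2.2.2.2 R hR.orderBounded hR
    exact (hπ.2 _ (h.1 e he)).2.trans (h.2 e he)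
  have h2 : π (p V e) ≤ V e := by
    have h := (hPs p hp).2.2.2.2 V hV0.orderBounded hV0
    exact (hπ.2 _ (h.1 e he)).2.trans (h.2 e he)
  have h3 : π (p (H - V) e) ≤ ε • S e := by
    have h := hπ.mono ((hPs p hp).mono (hH.orderBounded.sub hV0.orderBounded)
      (opLE_zero_smul hS n.cast_nonneg).orderBounded hHV e he)
    rw [(hPs p hp).2.1, LinearMap.smul_apply, map_smul] at h
    refine h.trans ((smul_le_smul_of_nonneg_left hpe n.cast_nonneg).trans ?_)
    rw [smul_smul]
    refine smul_le_smul_right_of_nonneg ?_ (hS e he)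
    rw [mul_div_assoc', div_le_iff₀ hn]
    nlinarith
  have h4 : p (R + H) = p R + (p (H - V) + p V) := by
    rw [← (hPs p hp).1 (H - V) V, sub_add_cancel, (hPs p hp).1]
  rw [h4, LinearMap.add_apply, LinearMap.add_apply, map_add, map_add, add_comm]
  exact add_le_add (add_le_add h3 h2) h1

theorem IsBandProjection.zero : IsBandProjection (0 : F →ₗ[ℝ] F) :=
  ⟨by simp, fun x hx => ⟨le_rfl, hx⟩⟩

end Helpers

theorem principal_band_projection_representation_op
    [Lattice E] [AddCommGroup E] [Module ℝ E]
    [CovariantClass E E (· + ·) (· ≤ ·)] [PosSMulMono ℝ E]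
    [ConditionallyCompleteLattice F] [AddCommGroup F] [Module ℝ F]
    [CovariantClass F F (· + ·) (· ≤ ·)] [PosSMulMono ℝ F]
    (hArchE : ∀ x y : E, (∀ n : ℕ, n • x ≤ y) → x ≤ 0)
    (hArchF : ∀ x y : F, (∀ n : ℕ, n • x ≤ y) → x ≤ 0)
    (Ps : Set ((E →ₗ[ℝ] F) → (E →ₗ[ℝ] F))) (hPs : ∀ p ∈ Ps, IsBandProjLb p)
    (hgen : ∀ T : E →ₗ[ℝ] F, OrderBounded T → opLE 0 T →
      ∀ x : E, IsLUB ((fun p => p T x) '' Ps) (T (x ⊔ 0)))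
    (S T : E →ₗ[ℝ] F) (hS : OrderBounded S) (hT : OrderBounded T)
    (hSpos : opLE 0 S) (hTpos : opLE 0 T)
    -- `TS = T_S`: the band projection of `T` onto `{S}^⊥⊥`
    (TS : E →ₗ[ℝ] F) (hTS : OrderBounded TS) (hTSpos : opLE 0 TS) (hTSle : opLE TS T)
    (hTSband : InBandOp S TS) (hTSdisj : DisjOp (T - TS) S) :
    ∀ e : E, 0 ≤ e →
      ((T - TS) e = sInf {r : F | ∃ ε : ℝ, 0 < ε ∧
          r = sSup {s : F | ∃ (π : F →ₗ[ℝ] F) (p : (E →ₗ[ℝ] F) → (E →ₗ[ℝ] F)),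
            IsBandProjection π ∧ p ∈ Ps ∧ π (p S e) ≤ ε • S e ∧ s = π (p T e)}}) ∧
      (TS e = sSup {r : F | ∃ ε : ℝ, 0 < ε ∧
          r = sInf {s : F | ∃ (π : F →ₗ[ℝ] F) (p : (E →ₗ[ℝ] F) → (E →ₗ[ℝ] F)),
            IsBandProjection π ∧ p ∈ Ps ∧ π (p S e) ≤ ε • S e ∧
              s = T e - π (p T e)}}) := by
  have : IsOrderedAddMonoid E :=
    { add_le_add_left := fun a b h c => by
        rw [add_comm a, add_comm b]; exact CovariantClass.elim c h
      add_le_add_right := fun _ _ h c => CovariantClass.elim c h }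
  have : IsOrderedAddMonoid F :=
    { add_le_add_left := fun a b h c => by
        rw [add_comm a, add_comm b]; exact CovariantClass.elim c h
      add_le_add_right := fun _ _ h c => CovariantClass.elim c h }
  intro e he
  rcases Ps.eq_empty_or_nonempty with rfl | ⟨p₀, hp₀⟩
  · have hbot : ∀ z : F, 0 ≤ z := fun z => by
      have h := (hgen 0 (opLE.orderBounded fun _ _ => le_rfl) (fun _ _ => le_rfl) 0).2
        (show z ∈ upperBounds _ by simp)
      simpa using h
    have : Subsingleton F := subsingleton_of_forall_eq 0 fun z =>
      le_antisymm (neg_nonneg.mp (hbot (-z))) (hbot z)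
    exact ⟨Subsingleton.elim _ _, Subsingleton.elim _ _⟩
  have hR : opLE 0 (T - TS) := fun x hx => sub_nonneg.mpr (hTSle x hx)
  have hRT : opLE (T - TS) T := fun x hx => sub_le_self _ (hTSpos x hx)
  set A : ℝ → Set F := fun ε => {s : F | ∃ (π : F →ₗ[ℝ] F)
    (p : (E →ₗ[ℝ] F) → (E →ₗ[ℝ] F)),
    IsBandProjection π ∧ p ∈ Ps ∧ π (p S e) ≤ ε • S e ∧ s = π (p T e)} with hA
  have hlub : ∀ ε : ℝ, 0 < ε → IsLUB (A ε) (sSup (A ε)) := by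
    intro ε hε
    refine isLUB_csSup ⟨0, 0, p₀, IsBandProjection.zero, hp₀,
      smul_nonneg hε.le (hSpos e he), rfl⟩ ⟨T e, ?_⟩
    rintro _ ⟨π, p, hπ, hp, -, rfl⟩
    have h := (hPs p hp).2.2.2.2 T hT hTpos
    exact (hπ.2 _ (h.1 e he)).2.trans (h.2 e he)
  have hglb : IsGLB {r : F | ∃ ε : ℝ, 0 < ε ∧ r = sSup (A ε)} ((T - TS) e) := by
    refine ⟨?_, fun b hb => ?_⟩
    · rintro _ ⟨ε, hε, rfl⟩
      exact hTSdisj.le_of_forall_localized hArchF hR hSpos hT hRT hPs hgen he hε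
        fun π p hp hπ hpe => (hlub ε hε).1 ⟨π, p, hπ, hp, hpe, rfl⟩
    · refine hTSband.le_of_forall_localized hArchF hR hSpos hTSpos hPs he
        fun ε a hε ha => (hb ⟨ε, hε, rfl⟩).trans ((hlub ε hε).2 ?_)
      rintro _ ⟨π, p, hπ, hp, hpe, rfl⟩
      rw [sub_add_cancel] at ha
      exact ha π p hp hπ hpe
  refine ⟨(hglb.csInf_eq ⟨_, 1, one_pos, rfl⟩).symm, ?_⟩
  have hinf : ∀ ε : ℝ, 0 < ε →
      sInf {s : F | ∃ (π : F →ₗ[ℝ] F) (p : (E →ₗ[ℝ] F) → (E →ₗ[ℝ] F)),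
        IsBandProjection π ∧ p ∈ Ps ∧ π (p S e) ≤ ε • S e ∧ s = T e - π (p T e)} =
      T e - sSup (A ε) := by
    intro ε hε
    refine IsGLB.csInf_eq ⟨?_, fun b hb => ?_⟩ ⟨_, 0, p₀, IsBandProjection.zero, hp₀,
      smul_nonneg hε.le (hSpos e he), rfl⟩
    · rintro _ ⟨π, p, hπ, hp, hpe, rfl⟩
      exact sub_le_sub_left ((hlub ε hε).1 ⟨π, p, hπ, hp, hpe, rfl⟩) _
    · rw [le_sub_comm]
      refine (hlub ε hε).2 ?_
      rintro _ ⟨π, p, hπ, hp, hpe, rfl⟩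
      exact le_sub_comm.mp (hb ⟨π, p, hπ, hp, hpe, rfl⟩)
  refine Eq.symm (IsLUB.csSup_eq ⟨?_, fun b hb => ?_⟩ ⟨_, 1, one_pos, rfl⟩)
  · rintro _ ⟨ε, hε, rfl⟩
    rw [hinf ε hε, sub_le_comm]
    exact hglb.1 ⟨ε, hε, rfl⟩
  · have h : T e - b ≤ (T - TS) e := by
      refine hglb.2 ?_
      rintro _ ⟨ε, hε, rfl⟩
      rw [sub_le_comm, ← hinf ε hε]
      exact hb ⟨ε, hε, rfl⟩
    exact (sub_le_sub_iff_left _).mp h
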